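/- arXiv:1202.6425 — 4 statements merged into one kernel-verified Lean document; each statement's English description precedes it below -/
import Mathlib

section
/- Let V be a 4-dimensional complex vector space equipped with a nondegenerate alternating bilinear form ϖ, and let ϖ̃ : ⋀²V → ℂ be the induced linear functional. A nonzero 2-vector w ∈ ⋀²V satisfies w ∧ w = 0 (in ⋀⁴V) and ϖ̃(w) = 0 if and only if w = u ∧ v for some basis u, v of a Lagrangian subspace of V; moreover two Lagrangian subspaces L, L′ yield the same line ℂ·(u ∧ v) in ⋀²V if and only if L = L′. (This is the identification of the Lagrangian Grassmannian Lag(V) with the quadric Q³ ⊂ P(⋀²₀V) via the Plücker embedding.) -/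
open ExteriorAlgebra

namespace ExteriorAlgebra

variable {K V : Type*} [Field K] [AddCommGroup V] [Module K V]

local infixl:70 "⌋" => CliffordAlgebra.contractLeft (Q := (0 : QuadraticForm K V))

theorem contractLeft_ι_mul (d : Module.Dual K V) (a : V) (x : ExteriorAlgebra K V) :
    d⌋(ι K a * x) = d a • x - ι K a * (d⌋x) :=
  CliffordAlgebra.contractLeft_ι_mul (Q := (0 : QuadraticForm K V)) d a x

theorem contractLeft_ι (d : Module.Dual K V) (a : V) :
    d⌋(ι K a) = algebraMap K (ExteriorAlgebra K V) (d a) :=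
  CliffordAlgebra.contractLeft_ι (Q := (0 : QuadraticForm K V)) d a

theorem contractLeft_ι_mul_ι (d : Module.Dual K V) (a b : V) :
    d⌋(ι K a * ι K b) = ι K (d a • b - d b • a) := by
  rw [contractLeft_ι_mul, contractLeft_ι, map_sub, map_smul, map_smul,
    ← Algebra.commutes, ← Algebra.smul_def]

theorem ι_mul_ι_anticomm (a b : V) : ι K a * ι K b = -(ι K b * ι K a) :=
  eq_neg_of_add_eq_zero_left (ι_add_mul_swap a b)

/-- Induction on 2-vectors. -/
theorem two_vector_induction {p : ExteriorAlgebra K V → Prop} {w : ExteriorAlgebra K V}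
    (hw : w ∈ ⋀[K]^2 V) (add : ∀ x y, p x → p y → p (x + y))
    (mul : ∀ a b, p (ι K a * ι K b)) : p w := by
  rw [exteriorPower, pow_two] at hw
  refine Submodule.mul_induction_on hw ?_ add
  rintro _ ⟨a, rfl⟩ _ ⟨b, rfl⟩
  exact mul a b

theorem exists_contractLeft_eq_ι (d : Module.Dual K V) {w : ExteriorAlgebra K V}
    (hw : w ∈ ⋀[K]^2 V) : ∃ a : V, d⌋w = ι K a := by
  refine two_vector_induction (p := fun w => ∃ a : V, d⌋w = ι K a) hw ?_
    fun a b => ⟨_, contractLeft_ι_mul_ι d a b⟩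
  rintro x y ⟨a, ha⟩ ⟨b, hb⟩
  refine ⟨a + b, ?_⟩
  simp only [map_add, ha, hb]

theorem contractLeft_two_vector_mul (d : Module.Dual K V) {w : ExteriorAlgebra K V}
    (hw : w ∈ ⋀[K]^2 V) (y : ExteriorAlgebra K V) :
    d⌋(w * y) = (d⌋w) * y + w * (d⌋y) := by
  refine two_vector_induction (p := fun w => d⌋(w * y) = (d⌋w) * y + w * (d⌋y)) hw ?_ ?_
  · intro x z hx hz
    simp only [add_mul, map_add, hx, hz]
    abel
  · intro a b
    have h := contractLeft_ι_mul_ι d a b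
    have h₁ := contractLeft_ι_mul d a (ι K b * y)
    have h₂ := contractLeft_ι_mul d b y
    rw [mul_assoc, h₁, h₂, h]
    simp only [map_sub, map_smul, mul_sub, sub_mul, mul_smul_comm, smul_mul_assoc, mul_assoc]
    abel

theorem two_vector_mul_ι {w : ExteriorAlgebra K V} (hw : w ∈ ⋀[K]^2 V) (x : V) :
    w * ι K x = ι K x * w := by
  refine two_vector_induction (p := fun w => w * ι K x = ι K x * w) hw ?_ ?_
  · intro y z hy hz
    rw [add_mul, mul_add, hy, hz]
  · intro a b
    rw [mul_assoc, ι_mul_ι_anticomm b x, mul_neg, ← mul_assoc, ι_mul_ι_anticomm a x, neg_mul,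
      neg_neg, mul_assoc]

/-- Euler's formula in degree two. -/
theorem sum_ι_mul_contractLeft_coord {I : Type*} [Fintype I] (e : Module.Basis I K V)
    {w : ExteriorAlgebra K V} (hw : w ∈ ⋀[K]^2 V) :
    ∑ i, ι K (e i) * (e.coord i⌋w) = (2 : K) • w := by
  refine two_vector_induction (p := fun w => ∑ i, ι K (e i) * (e.coord i⌋w) = (2 : K) • w)
    hw ?_ ?_
  · intro y z hy hz
    simp only [map_add, mul_add, Finset.sum_add_distrib, hy, hz, smul_add]
  · intro a b
    have h (i : I) : ι K (e i) * (e.coord i⌋(ι K a * ι K b)) =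
        ι K (e.repr a i • e i) * ι K b - ι K (e.repr b i • e i) * ι K a := by
      have := contractLeft_ι_mul_ι (e.coord i) a b
      rw [this]
      simp [mul_sub]
    rw [Finset.sum_congr rfl fun i _ => h i, Finset.sum_sub_distrib, ← Finset.sum_mul,
      ← Finset.sum_mul, ← map_sum, ← map_sum, e.sum_repr, e.sum_repr, ι_mul_ι_anticomm b a,
      sub_neg_eq_add, two_smul]

/-- A nonzero 2-vector with vanishing square is decomposable. -/
theorem exists_eq_ι_mul_ι_of_mul_self_eq_zero [FiniteDimensional K V] (h2 : (2 : K) ≠ 0)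
    {w : ExteriorAlgebra K V} (hw : w ∈ ⋀[K]^2 V) (hne : w ≠ 0) (hsq : w * w = 0) :
    ∃ u v : V, w = ι K u * ι K v := by
  let e := Module.finBasis K V
  obtain ⟨i, hi⟩ : ∃ i, e.coord i⌋w ≠ 0 := by
    by_contra! h
    have := sum_ι_mul_contractLeft_coord e hw
    simp only [h, mul_zero, Finset.sum_const_zero] at this
    exact (smul_ne_zero h2 hne) this.symm
  obtain ⟨a, ha⟩ := exists_contractLeft_eq_ι (e.coord i) hw
  obtain ⟨j, hj⟩ : ∃ j, e.coord j a ≠ 0 := by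
    by_contra! h
    refine hi (ha.trans ?_)
    rw [(e.forall_coord_eq_zero_iff).1 h, map_zero]
  obtain ⟨b, hb⟩ := exists_contractLeft_eq_ι (e.coord j) hw
  have haw : ι K a * w = 0 := by
    have h := contractLeft_two_vector_mul (e.coord i) hw w
    rw [hsq, map_zero, ha, two_vector_mul_ι hw, ← two_smul K] at h
    exact (smul_eq_zero_iff_right h2).1 h.symm
  have h := contractLeft_ι_mul (e.coord j) a w
  rw [haw, map_zero, hb, eq_comm, sub_eq_zero] at h
  refine ⟨(e.coord j a)⁻¹ • a, b, ?_⟩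
  rw [map_smul, smul_mul_assoc, ← h, inv_smul_smul₀ hj]

theorem exists_dual_eq_one_eq_zero {u v : V} (h : LinearIndependent K ![u, v]) :
    ∃ d : Module.Dual K V, d u = 1 ∧ d v = 0 := by
  have hu : u ∉ Submodule.span K {v} := by
    rw [Submodule.mem_span_singleton]
    rintro ⟨c, hc⟩
    have := LinearIndependent.pair_iff.1 h 1 (-c) (by rw [← hc]; simp)
    exact one_ne_zero this.1
  obtain ⟨f, hf, hle⟩ := Submodule.exists_le_ker_of_notMem hu
  have hv : f v = 0 := hle (Submodule.mem_span_singleton_self v)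
  exact ⟨(f u)⁻¹ • f, by simp [hf], by simp [hv]⟩

theorem ι_mul_ι_ne_zero_iff {u v : V} :
    ι K u * ι K v ≠ 0 ↔ LinearIndependent K ![u, v] := by
  refine ⟨fun h => ?_, fun h h0 => ?_⟩
  · rw [LinearIndependent.pair_iff]
    intro s t hst
    have hs := congrArg (fun x => ι K x * ι K v) hst
    have ht := congrArg (fun x => ι K u * ι K x) hst
    simp only [map_add, map_smul, map_zero, add_mul, mul_add, smul_mul_assoc, mul_smul_comm,
      ι_sq_zero, smul_zero, add_zero, zero_add, zero_mul, mul_zero, smul_eq_zero, h,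
      or_false] at hs ht
    exact ⟨hs, ht⟩
  · obtain ⟨d, hu, hv⟩ := exists_dual_eq_one_eq_zero h
    have hd := contractLeft_ι_mul_ι d u v
    rw [h0, map_zero, hu, hv, one_smul, zero_smul, sub_zero, eq_comm, ι_eq_zero_iff] at hd
    exact h.ne_zero 1 hd

theorem right_mem_span_pair_of_ι_mul_ι_mem {u v u' v' : V} (h : LinearIndependent K ![u, v])
    (hm : ι K u * ι K v ∈ Submodule.span K {ι K u' * ι K v'}) :
    v ∈ Submodule.span K {u', v'} := by
  obtain ⟨d, hu, hv⟩ := exists_dual_eq_one_eq_zero h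
  obtain ⟨c, hc⟩ := Submodule.mem_span_singleton.1 hm
  have hd := contractLeft_ι_mul_ι d u v
  have hd' := contractLeft_ι_mul_ι d u' v'
  rw [← hc, map_smul, hd', hu, hv, one_smul, zero_smul, sub_zero, ← map_smul, ι_inj] at hd
  rw [← hd]
  refine Submodule.smul_mem _ _ (Submodule.sub_mem _ ?_ ?_) <;>
    exact Submodule.smul_mem _ _ (Submodule.subset_span (by simp))

theorem ι_mul_ι_mem_span_iff {u v u' v' : V} (h : LinearIndependent K ![u, v]) :
    ι K u * ι K v ∈ Submodule.span K {ι K u' * ι K v'} ↔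
      Submodule.span K {u, v} ≤ Submodule.span K {u', v'} := by
  refine ⟨fun hm => ?_, fun hle => ?_⟩
  · rw [Submodule.span_le, Set.pair_subset_iff]
    refine ⟨right_mem_span_pair_of_ι_mul_ι_mem (LinearIndependent.pair_symm_iff.1 h) ?_,
      right_mem_span_pair_of_ι_mul_ι_mem h hm⟩
    rw [ι_mul_ι_anticomm v u]
    exact Submodule.neg_mem _ hm
  · obtain ⟨a, b, rfl⟩ := Submodule.mem_span_pair.1 (hle (Submodule.subset_span (by simp) :
      u ∈ Submodule.span K {u, v}))
    obtain ⟨c, d, rfl⟩ := Submodule.mem_span_pair.1 (hle (Submodule.subset_span (by simp) :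
      v ∈ Submodule.span K {_, v}))
    refine Submodule.mem_span_singleton.2 ⟨a * d - b * c, ?_⟩
    simp only [map_add, map_smul, add_mul, mul_add, smul_mul_assoc, mul_smul_comm, ι_sq_zero,
      ι_mul_ι_anticomm v' u']
    module

theorem span_ι_mul_ι_eq_iff {u v u' v' : V} (h : LinearIndependent K ![u, v])
    (h' : LinearIndependent K ![u', v']) :
    Submodule.span K {ι K u * ι K v} = Submodule.span K {ι K u' * ι K v'} ↔
      Submodule.span K {u, v} = Submodule.span K {u', v'} := by
  simp only [le_antisymm_iff, Submodule.span_singleton_le_iff_mem, ι_mul_ι_mem_span_iff h,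
    ι_mul_ι_mem_span_iff h']

theorem ι_mul_ι_mem_exteriorPower (u v : V) : ι K u * ι K v ∈ ⋀[K]^2 V := by
  rw [exteriorPower, pow_two]
  exact Submodule.mul_mem_mul ⟨u, rfl⟩ ⟨v, rfl⟩

theorem ι_mul_ι_mul_self (u v : V) : ι K u * ι K v * (ι K u * ι K v) = 0 := by
  rw [← mul_assoc, two_vector_mul_ι (ι_mul_ι_mem_exteriorPower u v), ← mul_assoc, ι_sq_zero,
    zero_mul, zero_mul]

end ExteriorAlgebra

theorem LinearMap.apply_eq_zero_of_mem_span_pair {K V : Type*} [Field K] [AddCommGroup V]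
    [Module K V] {B : V →ₗ[K] V →ₗ[K] K} (hB : ∀ v, B v v = 0) {u v : V} (h : B u v = 0)
    {a b : V} (ha : a ∈ Submodule.span K {u, v}) (hb : b ∈ Submodule.span K {u, v}) :
    B a b = 0 := by
  obtain ⟨s, t, rfl⟩ := Submodule.mem_span_pair.1 ha
  obtain ⟨s', t', rfl⟩ := Submodule.mem_span_pair.1 hb
  have hvu : B v u = 0 := by
    rw [← LinearMap.IsAlt.neg (B := B) hB, h, neg_zero]
  simp [hB, h, hvu]

/-- Let `V` be a 4-dimensional complex vector space with a nondegenerate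
alternating bilinear form `ϖ`, and let `ϖ̃ : ⋀²V → ℂ` be the induced linear functional
(characterized by `ϖ̃(u ∧ v) = ϖ(u, v)`; here realized as a linear functional on the
exterior algebra, evaluated only on the degree-2 part `⋀[ℂ]^2 V`).
A nonzero 2-vector `w` satisfies `w ∧ w = 0` and `ϖ̃(w) = 0` iff `w = u ∧ v` for some
basis `u, v` of a Lagrangian subspace of `V`; moreover two Lagrangian subspaces yield
the same line in `⋀²V` iff they are equal. (Identification of `Lag(V)` with the quadric
`Q³ ⊂ P(⋀²₀V)` via the Plücker embedding.) -/
theorem stmt_4 {V : Type*} [AddCommGroup V] [Module ℂ V] [FiniteDimensional ℂ V]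
    (ϖ : V →ₗ[ℂ] V →ₗ[ℂ] ℂ)
    (hdim : Module.finrank ℂ V = 4)
    (halt : ∀ v : V, ϖ v v = 0)
    (hnd : ∀ x : V, (∀ v : V, ϖ x v = 0) → x = 0)
    (ϖt : ExteriorAlgebra ℂ V →ₗ[ℂ] ℂ)
    (hϖt : ∀ u v : V, ϖt (ι ℂ u * ι ℂ v) = ϖ u v) :
    (∀ w : ExteriorAlgebra ℂ V, w ∈ ⋀[ℂ]^2 V →
      ((w ≠ 0 ∧ w * w = 0 ∧ ϖt w = 0) ↔
        ∃ u v : V, LinearIndependent ℂ ![u, v] ∧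
          (∀ a ∈ Submodule.span ℂ {u, v}, ∀ b ∈ Submodule.span ℂ {u, v}, ϖ a b = 0) ∧
          w = ι ℂ u * ι ℂ v))
    ∧
    (∀ L L' : Submodule ℂ V,
      (Module.finrank ℂ L = 2 ∧ ∀ a ∈ L, ∀ b ∈ L, ϖ a b = 0) →
      (Module.finrank ℂ L' = 2 ∧ ∀ a ∈ L', ∀ b ∈ L', ϖ a b = 0) →
      ∀ u v u' v' : V,
        LinearIndependent ℂ ![u, v] → Submodule.span ℂ {u, v} = L →
        LinearIndependent ℂ ![u', v'] → Submodule.span ℂ {u', v'} = L' →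
        (Submodule.span ℂ {ι ℂ u * ι ℂ v} = Submodule.span ℂ {ι ℂ u' * ι ℂ v'} ↔
          L = L')) := by
  refine ⟨fun w hw => ⟨?_, ?_⟩, ?_⟩
  · rintro ⟨hne, hsq, hϖ⟩
    obtain ⟨u, v, rfl⟩ := exists_eq_ι_mul_ι_of_mul_self_eq_zero two_ne_zero hw hne hsq
    rw [hϖt] at hϖ
    exact ⟨u, v, ι_mul_ι_ne_zero_iff.1 hne,
      fun a ha b hb => LinearMap.apply_eq_zero_of_mem_span_pair halt hϖ ha hb, rfl⟩
  · rintro ⟨u, v, hli, hL, rfl⟩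
    refine ⟨ι_mul_ι_ne_zero_iff.2 hli, ι_mul_ι_mul_self u v, ?_⟩
    rw [hϖt]
    exact hL u (Submodule.subset_span (by simp)) v (Submodule.subset_span (by simp))
  · rintro _ _ - - u v u' v' h rfl h' rfl
    exact span_ι_mul_ι_eq_iff h h'
end

section
/- Let V be a 4-dimensional complex vector space equipped with a nondegenerate alternating bilinear form ϖ, and let ϖ̃ : ⋀²V → ℂ be the induced linear functional. For every nonzero x ∈ V, the set W_x := {x ∧ v : v ∈ V, ϖ(x, v) = 0} is a 2-dimensional linear subspace of ⋀²V contained in ker ϖ̃, and w ∧ w′ = 0 in ⋀⁴V for all w, w′ ∈ W_x. (Thus the fiber of π₀ over [x] ∈ P³, i.e. the pencil of Legendrian lines through [x], projects under π₁ to a null line P(W_x) ≅ P¹ contained in the quadric Q³.) -/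
open ExteriorAlgebra

/-- A vector wedging to zero with a vector on which `f` does not vanish is a multiple of it. -/
theorem ExteriorAlgebra.smul_eq_smul_of_ι_mul_ι_eq_zero {R M : Type*} [CommRing R]
    [AddCommGroup M] [Module R M] (f : Module.Dual R M) {x v : M}
    (h : ι R x * ι R v = 0) : f x • v = f v • x := by
  have key := CliffordAlgebra.contractLeft_ι_mul (Q := (0 : QuadraticForm R M)) f x
    (CliffordAlgebra.ι (0 : QuadraticForm R M) v)
  rw [CliffordAlgebra.contractLeft_ι] at key
  change CliffordAlgebra.contractLeft f (ι R x * ι R v) =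
    f x • ι R v - ι R x * algebraMap R (ExteriorAlgebra R M) (f v) at key
  rw [h, map_zero, ← Algebra.commutes, ← Algebra.smul_def, ← map_smul, ← map_smul,
    ← map_sub] at key
  exact sub_eq_zero.mp ((ι_eq_zero_iff _).mp key.symm)

/-- The linear map `v ↦ x ∧ v`. -/
noncomputable def ExteriorAlgebra.ιWedge (R : Type*) {M : Type*} [CommRing R] [AddCommGroup M]
    [Module R M] (x : M) : M →ₗ[R] ExteriorAlgebra R M :=
  LinearMap.mulLeft R (ι R x) ∘ₗ ι R

@[simp]
theorem ExteriorAlgebra.ιWedge_apply {R M : Type*} [CommRing R] [AddCommGroup M] [Module R M]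
    (x v : M) : ιWedge R x v = ι R x * ι R v := rfl

theorem ExteriorAlgebra.ker_ιWedge {K M : Type*} [Field K] [AddCommGroup M] [Module K M]
    {x : M} (hx : x ≠ 0) : (ιWedge K x).ker = K ∙ x := by
  ext v
  rw [LinearMap.mem_ker, ιWedge_apply, Submodule.mem_span_singleton]
  constructor
  · intro h
    obtain ⟨f, hf⟩ : ∃ f : Module.Dual K M, f x ≠ 0 := by
      by_contra! h0
      exact hx ((Module.forall_dual_apply_eq_zero_iff K x).mp h0)
    refine ⟨(f x)⁻¹ * f v, ?_⟩
    rw [mul_smul, ← smul_eq_smul_of_ι_mul_ι_eq_zero f h, inv_smul_smul₀ hf]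
  · rintro ⟨c, rfl⟩
    rw [map_smul, mul_smul_comm, ι_sq_zero, smul_zero]

theorem ExteriorAlgebra.finrank_map_ιWedge_add_one {K M : Type*} [Field K] [AddCommGroup M]
    [Module K M] {x : M} (hx : x ≠ 0) (S : Submodule K M) [FiniteDimensional K S] (hxS : x ∈ S) :
    Module.finrank K (S.map (ιWedge K x)) + 1 = Module.finrank K S := by
  have hker : ((ιWedge K x).domRestrict S).ker = K ∙ (⟨x, hxS⟩ : S) := by
    ext ⟨v, hv⟩
    have := SetLike.ext_iff.mp (ker_ιWedge (K := K) hx) v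
    rw [LinearMap.mem_ker, Submodule.mem_span_singleton] at this ⊢
    simpa [Subtype.ext_iff] using this
  have h := ((ιWedge K x).domRestrict S).finrank_range_add_finrank_ker
  rwa [hker, finrank_span_singleton (by simpa [Subtype.ext_iff] using hx),
    LinearMap.range_domRestrict] at h

theorem ExteriorAlgebra.ι_mul_ι_mul_ι_mul_ι_self {R M : Type*} [CommRing R] [AddCommGroup M]
    [Module R M] (x u v : M) : ι R x * ι R u * (ι R x * ι R v) = 0 := by
  have h : ι R x * ι R u = -(ι R u * ι R x) := eq_neg_of_add_eq_zero_left (ι_add_mul_swap x u)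
  rw [h, neg_mul, mul_assoc, ← mul_assoc (ι R x), ι_sq_zero, zero_mul, mul_zero, neg_zero]

/-- Let `V` be a 4-dimensional complex vector space with a nondegenerate
alternating bilinear form `ϖ`, and `ϖ̃` the induced linear functional on 2-vectors
(realized on the exterior algebra via `ϖ̃(u ∧ v) = ϖ(u, v)`). For every nonzero
`x ∈ V`, the set `W_x = {x ∧ v : v ∈ V, ϖ(x, v) = 0}` is a 2-dimensional linear
subspace of `⋀²V` contained in `ker ϖ̃`, and `w ∧ w′ = 0` for all `w, w′ ∈ W_x`.
(The pencil of Legendrian lines through `[x]` projects to a null line of `Q³`.) -/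
theorem stmt_6 {V : Type*} [AddCommGroup V] [Module ℂ V] [FiniteDimensional ℂ V]
    (ϖ : V →ₗ[ℂ] V →ₗ[ℂ] ℂ)
    (hdim : Module.finrank ℂ V = 4)
    (halt : ∀ v : V, ϖ v v = 0)
    (hnd : ∀ x : V, (∀ v : V, ϖ x v = 0) → x = 0)
    (ϖt : ExteriorAlgebra ℂ V →ₗ[ℂ] ℂ)
    (hϖt : ∀ u v : V, ϖt (ι ℂ u * ι ℂ v) = ϖ u v)
    (x : V) (hx : x ≠ 0) :
    ∃ W : Submodule ℂ (ExteriorAlgebra ℂ V),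
      (W : Set (ExteriorAlgebra ℂ V)) = {w | ∃ v : V, ϖ x v = 0 ∧ w = ι ℂ x * ι ℂ v} ∧
      Module.finrank ℂ W = 2 ∧
      (∀ w ∈ W, w ∈ ⋀[ℂ]^2 V ∧ ϖt w = 0) ∧
      (∀ w ∈ W, ∀ w' ∈ W, w * w' = 0) := by
  have hϖx : ϖ x ≠ 0 := fun h => hx (hnd x fun v => by rw [h, LinearMap.zero_apply])
  have hker := Module.Dual.finrank_ker_add_one_of_ne_zero hϖx
  have hmap := finrank_map_ιWedge_add_one hx (ϖ x).ker (halt x)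
  refine ⟨(ϖ x).ker.map (ιWedge ℂ x), ?_, by omega, ?_, ?_⟩
  · ext w
    simp [eq_comm]
  · rintro _ ⟨v, hv, rfl⟩
    refine ⟨?_, (hϖt x v).trans hv⟩
    rw [ιWedge_apply, exteriorPower, pow_two]
    exact Submodule.mul_mem_mul (LinearMap.mem_range_self _ x) (LinearMap.mem_range_self _ v)
  · rintro _ ⟨u, -, rfl⟩ _ ⟨v, -, rfl⟩
    exact ι_mul_ι_mul_ι_mul_ι_self x u v
end

section
/- Let g be a matrix in the symplectic group Sp₄(ℂ) = {g : gᵀ J g = J}, where J = [[0, I₂], [−I₂, 0]] in 2×2 block form. Then g satisfies g(ℂ·e₀) ⊆ ℂ·e₀ and g(span{e₀, e₁}) ⊆ span{e₀, e₁} if and only if g has the block form g = [[A, B], [0, (Aᵀ)⁻¹]] where A is an invertible upper-triangular 2×2 matrix and the 2×2 matrix A⁻¹B is symmetric, i.e. (A⁻¹B)ᵀ = A⁻¹B. (This identifies the stabilizer subgroup P of the flag ([Z₀], [Z₀ ∧ Z₁]) in the incidence double fibration Z = Sp₂ℂ/P.) -/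
open Matrix

/-- The standard flag in a four-dimensional space is stable under a matrix exactly when its
lower-left block vanishes and its upper-left block is upper triangular. -/
theorem flag_stable_iff {K : Type*} [Field K] (A B C D : Matrix (Fin 2) (Fin 2) K) :
    (Submodule.map (fromBlocks A B C D).mulVecLin
        (Submodule.span K {(Pi.single (Sum.inl 0) 1 : Fin 2 ⊕ Fin 2 → K)}) ≤
      Submodule.span K {(Pi.single (Sum.inl 0) 1 : Fin 2 ⊕ Fin 2 → K)} ∧
     Submodule.map (fromBlocks A B C D).mulVecLin
        (Submodule.span K {(Pi.single (Sum.inl 0) 1 : Fin 2 ⊕ Fin 2 → K),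
          (Pi.single (Sum.inl 1) 1 : Fin 2 ⊕ Fin 2 → K)}) ≤
      Submodule.span K {(Pi.single (Sum.inl 0) 1 : Fin 2 ⊕ Fin 2 → K),
        (Pi.single (Sum.inl 1) 1 : Fin 2 ⊕ Fin 2 → K)})
    ↔ A 1 0 = 0 ∧ C = 0 := by
  have line (v : Fin 2 ⊕ Fin 2 → K) :
      v ∈ Submodule.span K {(Pi.single (Sum.inl 0) 1 : Fin 2 ⊕ Fin 2 → K)} ↔
        v (Sum.inl 1) = 0 ∧ v (Sum.inr 0) = 0 ∧ v (Sum.inr 1) = 0 := by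
    rw [Submodule.mem_span_singleton]
    constructor
    · rintro ⟨a, rfl⟩
      simp
    · rintro ⟨h₁, h₂, h₃⟩
      refine ⟨v (Sum.inl 0), ?_⟩
      ext (i | i) <;> fin_cases i <;> simp [h₁, h₂, h₃]
  have plane (v : Fin 2 ⊕ Fin 2 → K) :
      v ∈ Submodule.span K {(Pi.single (Sum.inl 0) 1 : Fin 2 ⊕ Fin 2 → K),
          (Pi.single (Sum.inl 1) 1 : Fin 2 ⊕ Fin 2 → K)} ↔
        v (Sum.inr 0) = 0 ∧ v (Sum.inr 1) = 0 := by
    rw [Submodule.mem_span_pair]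
    constructor
    · rintro ⟨a, b, rfl⟩
      simp
    · rintro ⟨h₁, h₂⟩
      refine ⟨v (Sum.inl 0), v (Sum.inl 1), ?_⟩
      ext (i | i) <;> fin_cases i <;> simp [h₁, h₂]
  simp only [Submodule.map_span, Set.image_singleton, Set.image_pair, Submodule.span_le,
    Set.singleton_subset_iff, Set.insert_subset_iff, SetLike.mem_coe, line, plane,
    mulVecLin_apply, mulVec_single_one, col_apply, fromBlocks_apply₁₁, fromBlocks_apply₂₁]
  rw [← Matrix.ext_iff]
  simp only [Fin.forall_fin_two, Matrix.zero_apply]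
  tauto

/-- A block upper triangular matrix preserving the standard symplectic form has
lower-right block `(Aᵀ)⁻¹`, with `A` invertible and `A⁻¹ * B` symmetric. -/
theorem block_upper_of_symplectic {n R : Type*} [Fintype n] [DecidableEq n] [CommRing R]
    {A B D : Matrix n n R}
    (h : (fromBlocks A B 0 D)ᵀ * fromBlocks (0 : Matrix n n R) 1 (-1) 0 * fromBlocks A B 0 D =
      fromBlocks (0 : Matrix n n R) 1 (-1) 0) :
    IsUnit A ∧ (A⁻¹ * B)ᵀ = A⁻¹ * B ∧ D = (Aᵀ)⁻¹ := by
  simp only [fromBlocks_transpose, fromBlocks_multiply, fromBlocks_inj] at h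
  obtain ⟨-, h₁, -, h₂⟩ := h
  have hAD : Aᵀ * D = 1 := by simpa using h₁
  have hBD : Bᵀ * D = Dᵀ * B := by
    have : -(Dᵀ * B) + Bᵀ * D = 0 := by simpa using h₂
    exact (neg_add_eq_zero.mp this).symm
  have hDA : Dᵀ * A = 1 := by simpa using congrArg transpose hAD
  have hD : D = (Aᵀ)⁻¹ := (inv_eq_right_inv hAD).symm
  have hA : A⁻¹ = Dᵀ := inv_eq_left_inv hDA
  refine ⟨IsUnit.of_mul_eq_one_right _ hDA, ?_, hD⟩
  rw [hA, transpose_mul, transpose_transpose, hBD]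

/-- Let `g` be a matrix in the symplectic group `Sp₄(ℂ)`, i.e.
`gᵀ J g = J` where `J = [[0, I₂], [−I₂, 0]]` in 2×2 block form (indices
`Fin 2 ⊕ Fin 2`, with `e₀ = inl 0`, `e₁ = inl 1`, `e₂ = inr 0`, `e₃ = inr 1`).
Then `g` stabilizes `ℂ·e₀` and `span{e₀, e₁}` iff `g = [[A, B], [0, (Aᵀ)⁻¹]]`
with `A` invertible upper-triangular and `A⁻¹B` symmetric.
(This identifies the stabilizer subgroup `P` of the flag `([Z₀], [Z₀ ∧ Z₁])`.) -/
theorem stmt_8 (g : Matrix (Fin 2 ⊕ Fin 2) (Fin 2 ⊕ Fin 2) ℂ)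
    (hg : gᵀ * Matrix.fromBlocks (0 : Matrix (Fin 2) (Fin 2) ℂ) 1 (-1) 0 * g =
      Matrix.fromBlocks (0 : Matrix (Fin 2) (Fin 2) ℂ) 1 (-1) 0) :
    (Submodule.map g.mulVecLin
        (Submodule.span ℂ {(Pi.single (Sum.inl 0) 1 : Fin 2 ⊕ Fin 2 → ℂ)}) ≤
      Submodule.span ℂ {(Pi.single (Sum.inl 0) 1 : Fin 2 ⊕ Fin 2 → ℂ)} ∧
     Submodule.map g.mulVecLin
        (Submodule.span ℂ {(Pi.single (Sum.inl 0) 1 : Fin 2 ⊕ Fin 2 → ℂ),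
          (Pi.single (Sum.inl 1) 1 : Fin 2 ⊕ Fin 2 → ℂ)}) ≤
      Submodule.span ℂ {(Pi.single (Sum.inl 0) 1 : Fin 2 ⊕ Fin 2 → ℂ),
        (Pi.single (Sum.inl 1) 1 : Fin 2 ⊕ Fin 2 → ℂ)})
    ↔
    ∃ A B : Matrix (Fin 2) (Fin 2) ℂ,
      IsUnit A ∧ A 1 0 = 0 ∧ (A⁻¹ * B)ᵀ = A⁻¹ * B ∧
      g = Matrix.fromBlocks A B 0 (Aᵀ)⁻¹ := by
  obtain ⟨A, B, C, D, rfl⟩ : ∃ A B C D, g = fromBlocks A B C D :=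
    ⟨_, _, _, _, (fromBlocks_toBlocks g).symm⟩
  rw [flag_stable_iff]
  constructor
  · rintro ⟨hA, rfl⟩
    obtain ⟨hU, hS, rfl⟩ := block_upper_of_symplectic hg
    exact ⟨A, B, hU, hA, hS, rfl⟩
  · rintro ⟨A', B', -, hA, -, h⟩
    obtain ⟨rfl, -, rfl, -⟩ := fromBlocks_inj.mp h
    exact ⟨hA, rfl⟩
end

section
/- Let a₀, b₁, b₃ be complex numbers satisfying the three polynomial equations (b₁ − b₃)·(4b₁ + 4b₃ − 11a₀²) = 0, (4b₁ + 5a₀²)·(2b₁ + 4b₃ − 3a₀²) = 0, and a₀·(185a₀⁴ − 60a₀²b₃ − 220a₀²b₁ − 208b₁b₃) = 0. Then a₀ = 0, b₁ = 0, and b₃ = 0. (This is the root computation for the reduced compatibility system (Eq₁ − Eq₃, Eq₁, Eq₀) of the linear Legendrian deformation at a flat point; it is the algebraic core of the paper's Theorem 3.2, forcing the deformation parameters a₀, b₁, b₃ to vanish and hence the deformation to be trivial.) -/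
/-- If the complex numbers `a₀, b₁, b₃` satisfy the three polynomial
compatibility equations
`(b₁ − b₃)(4b₁ + 4b₃ − 11a₀²) = 0`,
`(4b₁ + 5a₀²)(2b₁ + 4b₃ − 3a₀²) = 0`,
`a₀(185a₀⁴ − 60a₀²b₃ − 220a₀²b₁ − 208b₁b₃) = 0`,
then `a₀ = b₁ = b₃ = 0`. (Root computation for the reduced compatibility system
`(Eq₁ − Eq₃, Eq₁, Eq₀)` of the linear Legendrian deformation at a flat point: the
algebraic core of the paper's Theorem 3.2, forcing the deformation parameters to
vanish and hence the deformation to be trivial.) -/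
theorem stmt_15 (a₀ b₁ b₃ : ℂ)
    (h₁ : (b₁ - b₃) * (4 * b₁ + 4 * b₃ - 11 * a₀ ^ 2) = 0)
    (h₂ : (4 * b₁ + 5 * a₀ ^ 2) * (2 * b₁ + 4 * b₃ - 3 * a₀ ^ 2) = 0)
    (h₃ : a₀ * (185 * a₀ ^ 4 - 60 * a₀ ^ 2 * b₃ - 220 * a₀ ^ 2 * b₁ - 208 * b₁ * b₃) = 0) :
    a₀ = 0 ∧ b₁ = 0 ∧ b₃ = 0 := by
  have key : ∀ s t c : ℂ, b₁ = s * a₀ ^ 2 → b₃ = t * a₀ ^ 2 →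
      c = 185 - 60 * t - 220 * s - 208 * s * t → c ≠ 0 → a₀ = 0 ∧ b₁ = 0 ∧ b₃ = 0 := by
    intro s t c hs ht hc hc0
    have h : c * a₀ ^ 5 = 0 := by
      rw [hs, ht] at h₃
      rw [hc]
      linear_combination h₃
    have ha : a₀ = 0 := by simpa [hc0] using h
    simp [hs, ht, ha]
  rcases mul_eq_zero.mp h₁ with h | h <;> rcases mul_eq_zero.mp h₂ with h' | h'
  · exact key (-5 / 4) (-5 / 4) 210 (by linear_combination h' / 4)
      (by linear_combination h' / 4 - h) (by norm_num) (by norm_num)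
  · exact key (1 / 2) (1 / 2) (-7) (by linear_combination h' / 6 + 2 / 3 * h)
      (by linear_combination h' / 6 - h / 3) (by norm_num) (by norm_num)
  · exact key (-5 / 4) 4 1260 (by linear_combination h' / 4)
      (by linear_combination h / 4 - h' / 4) (by norm_num) (by norm_num)
  · exact key 4 (-5 / 4) 420 (by linear_combination h / 2 - h' / 2)
      (by linear_combination h' / 2 - h / 4) (by norm_num) (by norm_num)
end
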